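/- arXiv:2209.12532 — 2 statements merged into one kernel-verified Lean document; each statement's English description precedes it below -/
import Mathlib

section
/- Let μ be a Borel measure on (0,∞) and let α > 0. Then the following are equivalent: (i) there exists C > 0 such that μ((0,s)) ≤ C·s^α for all s ≥ 1; (ii) there exists C′ > 0 such that ∫_{(0,∞)} e^{−tλ} dμ(λ) ≤ C′·t^{−α} for all t ∈ (0,1]. -/
open MeasureTheory Set

lemma aux_summable (α : ℝ) :
    Summable (fun n : ℕ => Real.exp (-(n : ℝ)) * ((n : ℝ) + 1) ^ α) := by
  have h := (summable_nat_add_iff 1).2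
    (Real.summable_pow_mul_exp_neg_nat_mul ⌈α⌉₊ (r := 1) one_pos)
  refine Summable.of_nonneg_of_le (fun n => by positivity) (fun n => ?_)
    (h.mul_left (Real.exp 1))
  have h1 : ((n : ℝ) + 1) ^ α ≤ ((n : ℝ) + 1) ^ ⌈α⌉₊ := by
    rw [← Real.rpow_natCast]
    exact Real.rpow_le_rpow_of_exponent_le (by linarith [n.cast_nonneg (α := ℝ)]) (Nat.le_ceil α)
  have h2 : Real.exp (-(n : ℝ)) = Real.exp 1 * Real.exp (-1 * ((n + 1 : ℕ) : ℝ)) := by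
    rw [← Real.exp_add]; congr 1; push_cast; ring
  rw [h2]
  push_cast
  calc _ ≤ Real.exp 1 * Real.exp (-1 * ((n : ℝ) + 1)) * ((n : ℝ) + 1) ^ ⌈α⌉₊ := by gcongr
    _ = _ := by ring

/-- For a Borel measure `μ` on `(0,∞)` and `α > 0`, polynomial growth of the spectral
distribution function `s ↦ μ((0,s))` for large `s` is equivalent to power decay of the
Laplace transform `t ↦ ∫_{(0,∞)} e^{-tλ} dμ(λ)` for small `t`. -/
theorem measure_Ioo_le_iff_lintegral_exp_le
    (μ : Measure ℝ) (α : ℝ) (hα : 0 < α) :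
    (∃ C > (0 : ℝ), ∀ s ≥ (1 : ℝ), μ (Ioo 0 s) ≤ ENNReal.ofReal (C * s ^ α)) ↔
      (∃ C' > (0 : ℝ), ∀ t ∈ Ioc (0 : ℝ) 1,
        (∫⁻ l in Ioi (0 : ℝ), ENNReal.ofReal (Real.exp (-t * l)) ∂μ) ≤
          ENNReal.ofReal (C' * t ^ (-α))) := by
  constructor
  · rintro ⟨C, hC, h⟩
    have hs := aux_summable α
    have hpos : 0 < ∑' n : ℕ, Real.exp (-(n : ℝ)) * ((n : ℝ) + 1) ^ α :=
      hs.tsum_pos (fun n => by positivity) 0 (by positivity)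
    refine ⟨C * ∑' n : ℕ, Real.exp (-(n : ℝ)) * ((n : ℝ) + 1) ^ α, by positivity, ?_⟩
    rintro t ⟨ht0, ht1⟩
    calc (∫⁻ l in Ioi (0 : ℝ), ENNReal.ofReal (Real.exp (-t * l)) ∂μ)
        ≤ ∫⁻ l in Ioi (0 : ℝ), ∑' n : ℕ, (Ioo (0 : ℝ) (((n : ℝ) + 1) / t)).indicator
            (fun _ => ENNReal.ofReal (Real.exp (-(n : ℝ)))) l ∂μ := by
          refine setLIntegral_mono' measurableSet_Ioi (fun l hl => ?_)
          have hl : 0 < l := hl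
          refine le_trans ?_ (ENNReal.le_tsum ⌊t * l⌋₊)
          have hm : l ∈ Ioo (0 : ℝ) (((⌊t * l⌋₊ : ℝ) + 1) / t) := by
            refine ⟨hl, ?_⟩
            rw [lt_div_iff₀ ht0, mul_comm]
            exact Nat.lt_floor_add_one _
          rw [indicator_of_mem hm]
          apply ENNReal.ofReal_le_ofReal
          apply Real.exp_le_exp.2
          have := Nat.floor_le (a := t * l) (by positivity)
          linarith
      _ ≤ ∫⁻ l, ∑' n : ℕ, (Ioo (0 : ℝ) (((n : ℝ) + 1) / t)).indicator
            (fun _ => ENNReal.ofReal (Real.exp (-(n : ℝ)))) l ∂μ := setLIntegral_le_lintegral _ _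
      _ = ∑' n : ℕ, ENNReal.ofReal (Real.exp (-(n : ℝ))) * μ (Ioo (0 : ℝ) (((n : ℝ) + 1) / t)) := by
          rw [lintegral_tsum
            (fun n => (measurable_const.indicator measurableSet_Ioo).aemeasurable)]
          congr 1; ext n
          rw [lintegral_indicator_const measurableSet_Ioo]
      _ ≤ ∑' n : ℕ, ENNReal.ofReal
            ((C * t ^ (-α)) * (Real.exp (-(n : ℝ)) * ((n : ℝ) + 1) ^ α)) := by
          refine ENNReal.tsum_le_tsum (fun n => ?_)
          have hn : (0 : ℝ) ≤ n := n.cast_nonneg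
          have h1 := h (((n : ℝ) + 1) / t) (by
            rw [ge_iff_le, le_div_iff₀ ht0]; linarith)
          refine (mul_le_mul_right h1 _).trans ?_
          rw [← ENNReal.ofReal_mul (Real.exp_pos _).le]
          apply le_of_eq
          congr 1
          rw [Real.div_rpow (by positivity) ht0.le, Real.rpow_neg ht0.le]
          ring
      _ = ENNReal.ofReal ((C * ∑' n : ℕ, Real.exp (-(n : ℝ)) * ((n : ℝ) + 1) ^ α) * t ^ (-α)) := by
          rw [← ENNReal.ofReal_tsum_of_nonneg (fun n => by positivity) (hs.mul_left _),
            tsum_mul_left]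
          congr 1; ring
  · rintro ⟨C, hC, h⟩
    refine ⟨Real.exp 1 * C, by positivity, fun s hs => ?_⟩
    have hs0 : 0 < s := by linarith
    have h1 := h s⁻¹ ⟨by positivity, inv_le_one_of_one_le₀ hs⟩
    rw [Real.rpow_neg (by positivity), Real.inv_rpow hs0.le, inv_inv] at h1
    calc μ (Ioo 0 s) = ∫⁻ l in Ioo 0 s, 1 ∂μ := by simp
      _ ≤ ∫⁻ l in Ioo 0 s, ENNReal.ofReal (Real.exp 1) *
            ENNReal.ofReal (Real.exp (-s⁻¹ * l)) ∂μ := by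
          refine setLIntegral_mono' measurableSet_Ioo (fun l hl => ?_)
          rw [← ENNReal.ofReal_mul (Real.exp_pos _).le, ← Real.exp_add]
          apply ENNReal.one_le_ofReal.2
          apply Real.one_le_exp
          have : s⁻¹ * l ≤ 1 := by
            rw [inv_mul_le_iff₀ hs0]; linarith [hl.2]
          linarith
      _ ≤ ∫⁻ l in Ioi 0, ENNReal.ofReal (Real.exp 1) *
            ENNReal.ofReal (Real.exp (-s⁻¹ * l)) ∂μ := lintegral_mono_set Ioo_subset_Ioi_self
      _ = ENNReal.ofReal (Real.exp 1) * ∫⁻ l in Ioi 0,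
            ENNReal.ofReal (Real.exp (-s⁻¹ * l)) ∂μ := by
          rw [lintegral_const_mul' _ _ ENNReal.ofReal_ne_top]
      _ ≤ ENNReal.ofReal (Real.exp 1) * ENNReal.ofReal (C * s ^ α) := by gcongr
      _ = _ := by
          rw [← ENNReal.ofReal_mul (Real.exp_pos _).le, mul_assoc]
end

section
/- Let (X, μ) be a measure space, let ρ : X → [0,∞) be measurable, and let b > 0, m > 1, Q > 0, β > 0, c₁ > 0, c₂ > 0 be constants such that μ({x ∈ X : ρ(x) ≤ r}) ≤ c₁·r^Q for all r ∈ (0,1] and μ({x ∈ X : ρ(x) ≤ r}) ≤ c₂·e^{βr} for all r ≥ 1. Then there exist C > 0 and t₀ > 0 such that for all t ∈ (0, t₀], I(t) = ∫_X exp(−b·(ρ(x)^m / t)^{1/(m−1)}) dμ(x) ≤ C·t^{Q/m}. -/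
open MeasureTheory Set

/-- If sublevel sets of `ρ` have measure `≤ c₁·r^Q` for small radii and at most exponential
growth for large radii, then `I(t) = ∫_X exp(-b·(ρ(x)^m / t)^(1/(m-1))) dμ(x) ≤ C·t^(Q/m)`
for all sufficiently small `t > 0`. -/
theorem lintegral_exp_gaussian_type_le_rpow
    {X : Type*} [MeasurableSpace X] (μ : Measure X)
    (ρ : X → ℝ) (hρ : Measurable ρ) (hρ0 : ∀ x, 0 ≤ ρ x)
    (b m Q β c₁ c₂ : ℝ) (hb : 0 < b) (hm : 1 < m) (hQ : 0 < Q) (hβ : 0 < β)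
    (hc₁ : 0 < c₁) (hc₂ : 0 < c₂)
    (hsmall : ∀ r ∈ Ioc (0 : ℝ) 1, μ {x | ρ x ≤ r} ≤ ENNReal.ofReal (c₁ * r ^ Q))
    (hlarge : ∀ r ≥ (1 : ℝ), μ {x | ρ x ≤ r} ≤ ENNReal.ofReal (c₂ * Real.exp (β * r))) :
    ∃ C > (0 : ℝ), ∃ t₀ > (0 : ℝ), ∀ t ∈ Ioc (0 : ℝ) t₀,
      (∫⁻ x, ENNReal.ofReal (Real.exp (-b * (ρ x ^ m / t) ^ (1 / (m - 1)))) ∂μ) ≤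
        ENNReal.ofReal (C * t ^ (Q / m)) := by
  have hK : 0 < c₁ + c₂ := by positivity
  have hm0 : 0 < m := by linarith
  have hV : ∀ r : ℝ, 0 < r → μ {x | ρ x ≤ r} ≤
      ENNReal.ofReal ((c₁ + c₂) * (r ^ Q * Real.exp (β * r))) := by
    intro r hr
    have hrQ : 0 < r ^ Q := Real.rpow_pos_of_pos hr Q
    rcases le_total r 1 with h | h
    · refine (hsmall r ⟨hr, h⟩).trans (ENNReal.ofReal_le_ofReal ?_)
      have h1 : 1 ≤ Real.exp (β * r) := Real.one_le_exp (by positivity)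
      have h2 : r ^ Q ≤ r ^ Q * Real.exp (β * r) := le_mul_of_one_le_right hrQ.le h1
      exact mul_le_mul (by linarith) h2 hrQ.le hK.le
    · refine (hlarge r h).trans (ENNReal.ofReal_le_ofReal ?_)
      have h1 : 1 ≤ r ^ Q := Real.one_le_rpow h hQ.le
      have h2 : Real.exp (β * r) ≤ r ^ Q * Real.exp (β * r) :=
        le_mul_of_one_le_left (Real.exp_pos _).le h1
      exact mul_le_mul (by linarith) h2 (Real.exp_pos _).le hK.le
  let d : ℕ → ℝ := fun n =>
    (c₁ + c₂) * (((n : ℝ) + 1) ^ Q * Real.exp (-b * n + b / 2 * (n + 1)))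
  have hd0 : ∀ n, 0 ≤ d n := fun n => by positivity
  have hds : Summable d := by
    have h0 := Real.summable_pow_mul_exp_neg_nat_mul ⌈Q⌉₊ (show 0 < b / 2 by positivity)
    have h1 := ((summable_nat_add_iff 1).2 h0).mul_left ((c₁ + c₂) * Real.exp b)
    refine Summable.of_nonneg_of_le hd0 (fun n => ?_) h1
    have e : Real.exp (-b * n + b / 2 * (n + 1)) =
        Real.exp b * Real.exp (-(b / 2) * ((n + 1 : ℕ) : ℝ)) := by
      rw [← Real.exp_add]; congr 1; push_cast; ring
    have h2 : ((n : ℝ) + 1) ^ Q ≤ ((n + 1 : ℕ) : ℝ) ^ ⌈Q⌉₊ := by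
      rw [← Real.rpow_natCast]
      push_cast
      exact Real.rpow_le_rpow_of_exponent_le (by linarith [n.cast_nonneg (α := ℝ)]) (Nat.le_ceil Q)
    simp only [d]
    rw [e]
    calc _ ≤ (c₁ + c₂) * (((n + 1 : ℕ) : ℝ) ^ ⌈Q⌉₊ *
          (Real.exp b * Real.exp (-(b / 2) * ((n + 1 : ℕ) : ℝ)))) := by gcongr
      _ = _ := by ring
  have hC0 : 0 ≤ ∑' n, d n := tsum_nonneg hd0
  refine ⟨(∑' n, d n) + 1, by linarith, (b / (2 * β)) ^ m, by positivity, ?_⟩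
  rintro t ⟨ht, htt⟩
  obtain ⟨s, hs, hsm⟩ : ∃ s : ℝ, 0 < s ∧ s ^ m = t :=
    ⟨t ^ (1 / m), by positivity, by rw [← Real.rpow_mul ht.le]; field_simp; simp⟩
  subst hsm
  have hsb : s ≤ b / (2 * β) :=
    (Real.rpow_le_rpow_iff hs.le (by positivity) hm0).1 htt
  have hβs : β * s ≤ b / 2 := by
    rw [le_div_iff₀ (by positivity)] at hsb; linarith
  have hsQ : (s ^ m) ^ (Q / m) = s ^ Q := by
    rw [← Real.rpow_mul hs.le]; congr 1; field_simp
  rw [hsQ]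
  have hS : ∀ n : ℕ, MeasurableSet {x | ρ x ≤ s * (n + 1)} := fun n =>
    measurableSet_le hρ measurable_const
  have hpt : ∀ x, ENNReal.ofReal (Real.exp (-b * (ρ x ^ m / s ^ m) ^ (1 / (m - 1)))) ≤
      ∑' n : ℕ, ({x | ρ x ≤ s * (n + 1)} : Set X).indicator
        (fun _ => ENNReal.ofReal (Real.exp (-b * n))) x := by
    intro x
    have hu : 0 ≤ ρ x / s := div_nonneg (hρ0 x) hs.le
    refine le_trans ?_ (ENNReal.le_tsum ⌊ρ x / s⌋₊)
    generalize hn : ⌊ρ x / s⌋₊ = n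
    have hx : x ∈ ({x | ρ x ≤ s * ((n : ℝ) + 1)} : Set X) := by
      have := Nat.lt_floor_add_one (ρ x / s)
      rw [hn, div_lt_iff₀ hs] at this
      simp only [mem_setOf_eq]; linarith
    rw [indicator_of_mem hx]
    refine ENNReal.ofReal_le_ofReal (Real.exp_le_exp.2 ?_)
    have hnu : (n : ℝ) ≤ ρ x / s := hn ▸ Nat.floor_le hu
    have key : (n : ℝ) ≤ (ρ x ^ m / s ^ m) ^ (1 / (m - 1)) := by
      rw [← Real.div_rpow (hρ0 x) hs.le, ← Real.rpow_mul hu]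
      rcases Nat.eq_zero_or_pos n with h | h
      · rw [h]; simp only [Nat.cast_zero]; positivity
      · have h1 : (1 : ℝ) ≤ n := by exact_mod_cast h
        refine hnu.trans (Real.self_le_rpow_of_one_le (h1.trans hnu) ?_)
        rw [mul_one_div, le_div_iff₀ (by linarith)]; linarith
    nlinarith
  calc _ ≤ ∫⁻ x, ∑' n : ℕ, ({x | ρ x ≤ s * (n + 1)} : Set X).indicator
        (fun _ => ENNReal.ofReal (Real.exp (-b * n))) x ∂μ := lintegral_mono hpt
    _ = ∑' n : ℕ, ENNReal.ofReal (Real.exp (-b * n)) * μ {x | ρ x ≤ s * (n + 1)} := by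
      rw [lintegral_tsum (fun n => (measurable_const.indicator (hS n)).aemeasurable)]
      exact tsum_congr fun n => lintegral_indicator_const (hS n) _
    _ ≤ ∑' n : ℕ, ENNReal.ofReal (d n * s ^ Q) := by
      refine ENNReal.tsum_le_tsum fun n => ?_
      have hn1 : (0 : ℝ) < n + 1 := by positivity
      refine (mul_le_mul_right (hV _ (mul_pos hs hn1)) _).trans ?_
      rw [← ENNReal.ofReal_mul (Real.exp_pos _).le]
      refine ENNReal.ofReal_le_ofReal ?_
      have h3 : Real.exp (β * (s * (n + 1))) ≤ Real.exp (b / 2 * (n + 1)) := by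
        refine Real.exp_le_exp.2 ?_
        rw [← mul_assoc]; gcongr
      simp only [d]
      rw [Real.mul_rpow hs.le hn1.le, Real.exp_add]
      calc _ ≤ Real.exp (-b * n) * ((c₁ + c₂) * (s ^ Q * ((n : ℝ) + 1) ^ Q *
            Real.exp (b / 2 * (n + 1)))) := by gcongr
        _ = _ := by ring
    _ = ENNReal.ofReal ((∑' n, d n) * s ^ Q) := by
      rw [← tsum_mul_right, ENNReal.ofReal_tsum_of_nonneg
        (fun n => mul_nonneg (hd0 n) (by positivity)) (hds.mul_right _)]
    _ ≤ _ := by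
      refine ENNReal.ofReal_le_ofReal ?_
      gcongr
      linarith
end
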